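/- Let P be a probability measure on ℝ^n that is absolutely continuous with respect to Lebesgue measure. Then the set 𝒬_C(M) of M-cell quantizers with convex cells is compact under total variation at input P: every sequence in 𝒬_C(M) has a subsequence {Q_{n_k}} and a quantizer Q ∈ 𝒬_C(M) such that ‖PQ_{n_k} − PQ‖_TV → 0. -/

import Mathlib

open MeasureTheory ProbabilityTheory Filter Topology

/-- The total variation distance `‖μ − ν‖_TV = 2 sup_B |μ(B) − ν(B)|`,
the supremum over measurable sets `B`. -/
noncomputable def tvDist {α : Type*} [MeasurableSpace α] (μ ν : Measure α) : ℝ :=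
  2 * ⨆ B : {B : Set α // MeasurableSet B}, |(μ B.1).toReal - (ν B.1).toReal|

/-- An `M`-cell quantizer with convex cells: a kernel `Q` from `ℝ^n` to `{1,…,M}` with
`Q(i|x) = 1_{B_i}(x)` for a Borel measurable partition `B_1,…,B_M` of `ℝ^n` into convex
sets (some cells may be empty). `𝒬_C(M)` is the set of all such quantizers. -/
def IsConvexQuantizer {n M : ℕ} (Q : Kernel (Fin n → ℝ) (Fin M)) : Prop :=
  ∃ B : Fin M → Set (Fin n → ℝ),
    (∀ i, MeasurableSet (B i)) ∧
    (∀ i, Convex ℝ (B i)) ∧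
    Pairwise (Function.onFun Disjoint B) ∧
    (⋃ i, B i) = Set.univ ∧
    ∀ x i, Q x {i} = (B i).indicator (fun _ => (1 : ENNReal)) x

/-- In finite dimension, an open set in which a convex set `S` is dense is contained in `S`. -/
theorem Convex.subset_of_isOpen_of_subset_closure {E : Type*} [NormedAddCommGroup E]
    [NormedSpace ℝ E] [FiniteDimensional ℝ E] {S U : Set E} (hS : Convex ℝ S) (hU : IsOpen U)
    (hUS : U ⊆ closure S) : U ⊆ S := by
  let _ : MeasurableSpace E := borel E
  have : BorelSpace E := ⟨rfl⟩
  by_cases hne : (interior S).Nonempty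
  · calc U ⊆ interior (closure S) := interior_maximal hUS hU
      _ = interior S := hS.interior_closure_eq_interior_of_nonempty_interior hne
      _ ⊆ S := interior_subset
  · have hfr : U ⊆ frontier S := by
      rw [frontier, Set.not_nonempty_iff_eq_empty.1 hne, Set.sdiff_empty]
      exact hUS
    have hU0 : (Measure.addHaar : Measure E) U = 0 :=
      measure_mono_null hfr (hS.addHaar_frontier _)
    rw [hU.measure_eq_zero_iff (μ := Measure.addHaar)] at hU0
    simp [hU0]

/-- In finite dimension, a convex set with convex complement is Borel. -/
theorem Convex.measurableSet_of_convex_compl {E : Type*} [NormedAddCommGroup E]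
    [NormedSpace ℝ E] [FiniteDimensional ℝ E] [MeasurableSpace E] [BorelSpace E]
    {C : Set E} (hC : Convex ℝ C) (hC' : Convex ℝ Cᶜ) : MeasurableSet C := by
  induction hd : Module.finrank ℝ E using Nat.strong_induction_on generalizing E with
  | _ d ih =>
  have key : ∀ D : Set E, Convex ℝ D → Convex ℝ Dᶜ → (interior D).Nonempty →
      MeasurableSet D := by
    intro D hD hD' hint
    rcases Set.eq_empty_or_nonempty Dᶜ with hemp | hne
    · rw [Set.compl_empty_iff.1 hemp]
      exact MeasurableSet.univ
    obtain ⟨f, u, hf, hfD, hfD'⟩ := geometric_hahn_banach_of_nonempty_interior hD hD'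
      (disjoint_compl_right.mono_left interior_subset) hint hne
    have hsplit : D = {x | f x < u} ∪ (D ∩ {x | f x = u}) := by
      ext x
      constructor
      · intro hx
        rcases (hfD x hx).lt_or_eq with h | h
        · exact Or.inl h
        · exact Or.inr ⟨hx, h⟩
      · rintro (h | h)
        · by_contra hx
          exact absurd (hfD' x hx) (not_le.2 h)
        · exact h.1
    rw [hsplit]
    refine (measurableSet_lt f.continuous.measurable measurable_const).union ?_
    rcases Set.eq_empty_or_nonempty (D ∩ {x | f x = u}) with hemp | ⟨p, -, hp⟩
    · rw [hemp]
      exact MeasurableSet.empty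
    let K : Submodule ℝ E := LinearMap.ker f.toLinearMap
    have hK : Module.finrank ℝ K < d := by
      rw [← hd]
      refine Submodule.finrank_lt fun htop => hf ?_
      ext x
      have hx : x ∈ K := htop ▸ Submodule.mem_top
      exact hx
    let g : K →ᵃ[ℝ] E := K.subtype.toAffineMap + AffineMap.const ℝ K p
    have hg : ∀ x : K, g x = (x : E) + p := fun x => rfl
    have hpre : MeasurableSet (g ⁻¹' D) :=
      ih _ hK (hD.affine_preimage g) (hD'.affine_preimage g) rfl
    have hemb : MeasurableEmbedding g :=
      (measurableEmbedding_addRight p).comp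
        (MeasurableEmbedding.subtype_coe K.closed_of_finiteDimensional.measurableSet)
    convert hemb.measurableSet_image' hpre using 1
    ext x
    constructor
    · rintro ⟨hxD, hx⟩
      refine ⟨⟨x - p, ?_⟩, ?_, ?_⟩
      · change f (x - p) = 0
        rw [map_sub, hx, hp, sub_self]
      · simpa [hg] using hxD
      · simp [hg]
    · rintro ⟨y, hy, rfl⟩
      refine ⟨hy, ?_⟩
      have hy0 : f (y : E) = 0 := y.2
      change f (y + p) = u
      rw [map_add, hy0, hp, zero_add]
  by_cases hint : (interior C).Nonempty
  · exact key C hC hC' hint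
  by_cases hint' : (interior Cᶜ).Nonempty
  · exact (key Cᶜ hC' (by rwa [compl_compl]) hint').of_compl
  · exfalso
    have hCU : (Set.univ : Set E) ⊆ C := by
      refine hC.subset_of_isOpen_of_subset_closure isOpen_univ fun x _ => ?_
      rw [closure_eq_compl_interior_compl, Set.not_nonempty_iff_eq_empty.1 hint']
      simp
    rw [Set.univ_subset_iff.1 hCU, interior_univ] at hint
    exact hint Set.univ_nonempty

/-- A map from a finite dimensional space to a countable type, all of whose fibres are convex,
is Borel measurable. -/
theorem measurable_of_convex_fibers {E ι : Type*} [NormedAddCommGroup E]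
    [NormedSpace ℝ E] [FiniteDimensional ℝ E] [MeasurableSpace E] [BorelSpace E]
    [Countable ι] [MeasurableSpace ι] {g : E → ι} (hg : ∀ i, Convex ℝ (g ⁻¹' {i})) :
    Measurable g := by
  refine measurable_to_countable' fun i => ?_
  have hsep : ∀ j, ∃ C : Set E, MeasurableSet C ∧ g ⁻¹' {i} ⊆ C ∧
      (j ≠ i → g ⁻¹' {j} ⊆ Cᶜ) := by
    intro j
    by_cases hj : j = i
    · exact ⟨Set.univ, MeasurableSet.univ, Set.subset_univ _, fun h => absurd hj h⟩
    · have hdisj : Disjoint (g ⁻¹' {i}) (g ⁻¹' {j}) :=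
        Disjoint.preimage g (Set.disjoint_singleton.2 (Ne.symm hj))
      obtain ⟨C, hC, hC', hi, hj'⟩ := exists_convex_convex_compl_subset (hg i) (hg j) hdisj
      exact ⟨C, hC.measurableSet_of_convex_compl hC', hi, fun _ => hj'⟩
  choose C hCm hCi hCj using hsep
  have heq : g ⁻¹' {i} = ⋂ j, C j := by
    refine Set.Subset.antisymm (Set.subset_iInter hCi) fun x hx => ?_
    by_contra hne
    exact hCj (g x) hne rfl (Set.mem_iInter.1 hx (g x))
  rw [heq]
  exact MeasurableSet.iInter hCm

/-- The set of points lying eventually in a family of convex sets is convex. -/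
theorem convex_setOf_eventually_mem {E α : Type*} [AddCommGroup E] [Module ℝ E] {l : Filter α}
    {S : α → Set E} (hS : ∀ a, Convex ℝ (S a)) : Convex ℝ {x | ∀ᶠ a in l, x ∈ S a} := by
  intro x hx y hy a b ha hb hab
  filter_upwards [hx, hy] with k hxk hyk
  exact hS k hxk hyk ha hb hab

/-- Convex partitions of a finite dimensional space into finitely many labelled cells are
sequentially compact for almost everywhere convergence. -/
theorem exists_subseq_ae_eventually_eq_of_convex_fibers {E ι : Type*} [NormedAddCommGroup E]
    [NormedSpace ℝ E] [FiniteDimensional ℝ E] [MeasurableSpace E] [BorelSpace E] [Finite ι]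
    (μ : Measure E) [μ.IsAddHaarMeasure] (g : ℕ → E → ι)
    (hg : ∀ k i, Convex ℝ (g k ⁻¹' {i})) :
    ∃ φ : ℕ → ℕ, StrictMono φ ∧ ∃ h : E → ι, (∀ i, Convex ℝ (h ⁻¹' {i})) ∧
      ∀ᵐ x ∂μ, ∀ᶠ k in atTop, g (φ k) x = h x := by
  let _ : TopologicalSpace ι := ⊥
  have : DiscreteTopology ι := ⟨rfl⟩
  obtain ⟨a, φ, hφ, ha⟩ := CompactSpace.tendsto_subseq
    fun k m => g k (TopologicalSpace.denseSeq E m)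
  have hdense : ∀ m, ∀ᶠ k in atTop, g (φ k) (TopologicalSpace.denseSeq E m) = a m := by
    intro m
    have := (tendsto_pi_nhds.1 ha) m
    rwa [nhds_discrete, tendsto_pure] at this
  have hlim : ∀ x, ∃ i, ∀ᶠ k in (hyperfilter ℕ : Filter ℕ), g (φ k) x = i := by
    intro x
    refine ⟨((hyperfilter ℕ).map fun k => g (φ k) x).lim, ?_⟩
    have := ((hyperfilter ℕ).map fun k => g (φ k) x).le_nhds_lim
    rwa [nhds_discrete, Filter.le_pure_iff] at this
  choose h hh using hlim
  have hiff : ∀ x i, h x = i ↔ ∀ᶠ k in (hyperfilter ℕ : Filter ℕ), g (φ k) x = i := by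
    intro x i
    refine ⟨fun hx => hx ▸ hh x, fun hx => ?_⟩
    obtain ⟨k, hk, hk'⟩ := ((hh x).and hx).exists
    exact hk.symm.trans hk'
  have hconv : ∀ i, Convex ℝ (h ⁻¹' {i}) := by
    intro i
    have : h ⁻¹' {i} = {x | ∀ᶠ k in (hyperfilter ℕ : Filter ℕ), x ∈ g (φ k) ⁻¹' {i}} :=
      Set.ext fun x => hiff x i
    rw [this]
    exact convex_setOf_eventually_mem fun k => hg (φ k) i
  refine ⟨φ, hφ, h, hconv, ?_⟩
  have hfr : ∀ᵐ x ∂μ, ∀ i, x ∉ frontier (h ⁻¹' {i}) :=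
    ae_all_iff.2 fun i => measure_eq_zero_iff_ae_notMem.1 ((hconv i).addHaar_frontier μ)
  filter_upwards [hfr] with x hx
  have hxint : x ∈ interior (h ⁻¹' {h x}) := by
    by_contra hxi
    exact hx (h x) ⟨subset_closure rfl, hxi⟩
  refine (convex_setOf_eventually_mem (l := atTop) fun k => hg (φ k) (h x))
    |>.subset_of_isOpen_of_subset_closure (isOpen_interior (s := h ⁻¹' {h x})) ?_ hxint
  refine ((TopologicalSpace.denseRange_denseSeq E).open_subset_closure_inter
    isOpen_interior).trans (closure_mono ?_)
  rintro _ ⟨hy, m, rfl⟩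
  have hm : h (TopologicalSpace.denseSeq E m) = a m :=
    (hiff _ _).2 (Nat.hyperfilter_le_atTop (hdense m))
  have hm' : h (TopologicalSpace.denseSeq E m) = h x :=
    interior_subset (s := h ⁻¹' {h x}) hy
  filter_upwards [hdense m] with k hk
  exact hk.trans (hm.symm.trans hm')

theorem tvDist_nonneg {α : Type*} [MeasurableSpace α] (μ ν : Measure α) : 0 ≤ tvDist μ ν :=
  mul_nonneg zero_le_two (Real.iSup_nonneg fun _ => abs_nonneg _)

/-- The joint laws of `(x, f x)` and `(x, g x)` are close if `f = g` with high probability. -/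
theorem tvDist_compProd_deterministic_le {α β : Type*} [MeasurableSpace α] [MeasurableSpace β]
    (μ : Measure α) [IsFiniteMeasure μ] {f g : α → β} (hf : Measurable f) (hg : Measurable g) :
    tvDist (μ ⊗ₘ Kernel.deterministic f hf) (μ ⊗ₘ Kernel.deterministic g hg) ≤
      2 * μ.real {x | f x ≠ g x} := by
  refine mul_le_mul_of_nonneg_left (Real.iSup_le ?_ measureReal_nonneg) zero_le_two
  rintro ⟨D, hD⟩
  have hf' : Measurable fun x => (x, f x) := measurable_id.prodMk hf
  have hg' : Measurable fun x => (x, g x) := measurable_id.prodMk hg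
  simp only [Measure.compProd_deterministic, Measure.map_apply hf' hD, Measure.map_apply hg' hD]
  refine (abs_measureReal_sub_le_measureReal_symmDiff (hf' hD).nullMeasurableSet
    (hg' hD).nullMeasurableSet).trans (measureReal_mono fun x hx hfg => ?_)
  simp [Set.mem_symmDiff, hfg] at hx

/-- A convex quantizer is the deterministic kernel of a labelling with convex fibres. -/
theorem IsConvexQuantizer.exists_eq_deterministic {n M : ℕ} {Q : Kernel (Fin n → ℝ) (Fin M)}
    (hQ : IsConvexQuantizer Q) :
    ∃ (g : (Fin n → ℝ) → Fin M) (hg : Measurable g),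
      (∀ i, Convex ℝ (g ⁻¹' {i})) ∧ Q = Kernel.deterministic g hg := by
  obtain ⟨B, -, hconv, hdisj, hcover, hQB⟩ := hQ
  have hmem : ∀ x, ∃ i, x ∈ B i := fun x =>
    Set.mem_iUnion.1 (hcover.symm ▸ Set.mem_univ x)
  choose g hgB using hmem
  have hiff : ∀ x i, g x = i ↔ x ∈ B i := fun x i =>
    ⟨fun h => h ▸ hgB x, fun h => by
      by_contra hne
      exact Set.disjoint_left.1 (hdisj hne) (hgB x) h⟩
  have hfib : ∀ i, g ⁻¹' {i} = B i := fun i => Set.ext fun x => hiff x i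
  have hgc : ∀ i, Convex ℝ (g ⁻¹' {i}) := fun i => hfib i ▸ hconv i
  refine ⟨g, measurable_of_convex_fibers hgc, hgc, ?_⟩
  ext1 x
  refine Measure.ext_of_singleton fun i => ?_
  rw [hQB, Kernel.deterministic_apply, Measure.dirac_apply, ← hfib i]
  rfl

/-- A labelling with convex fibres defines a convex quantizer. -/
theorem isConvexQuantizer_deterministic {n M : ℕ} {g : (Fin n → ℝ) → Fin M} (hg : Measurable g)
    (hgc : ∀ i, Convex ℝ (g ⁻¹' {i})) : IsConvexQuantizer (Kernel.deterministic g hg) := by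
  refine ⟨fun i => g ⁻¹' {i}, fun i => hg (measurableSet_singleton i), hgc,
    fun i j hij => Disjoint.preimage g (Set.disjoint_singleton.2 hij),
    Set.eq_univ_of_forall fun x => Set.mem_iUnion.2 ⟨g x, rfl⟩, fun x i => ?_⟩
  rw [Kernel.deterministic_apply, Measure.dirac_apply]
  rfl

/-- Theorem 5.7: if `P` is absolutely continuous with respect to Lebesgue measure, the
set `𝒬_C(M)` of `M`-cell quantizers with convex cells is compact under total variation
at input `P`: any sequence in `𝒬_C(M)` admits a subsequence converging in total
variation at input `P` to some quantizer in `𝒬_C(M)`. -/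
theorem stmt17 (n M : ℕ) (P : Measure (Fin n → ℝ)) [IsProbabilityMeasure P]
    (habs : P ≪ volume)
    (Qs : ℕ → Kernel (Fin n → ℝ) (Fin M)) [∀ j, IsMarkovKernel (Qs j)]
    (hq : ∀ j, IsConvexQuantizer (Qs j)) :
    ∃ φ : ℕ → ℕ, StrictMono φ ∧
      ∃ Q : Kernel (Fin n → ℝ) (Fin M), IsConvexQuantizer Q ∧
        Tendsto (fun i => tvDist (P ⊗ₘ Qs (φ i)) (P ⊗ₘ Q)) atTop (𝓝 0) := by
  choose g hgm hgc hQg using fun j => (hq j).exists_eq_deterministic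
  obtain ⟨φ, hφ, h, hhc, hae⟩ :=
    exists_subseq_ae_eventually_eq_of_convex_fibers volume g hgc
  have hhm : Measurable h := measurable_of_convex_fibers hhc
  refine ⟨φ, hφ, Kernel.deterministic h hhm, isConvexQuantizer_deterministic hhm hhc, ?_⟩
  have hlim : Tendsto (fun k => P {x | g (φ k) x ≠ h x}) atTop (𝓝 (P ∅)) := by
    refine tendsto_measure_of_ae_tendsto_indicator_of_isFiniteMeasure atTop MeasurableSet.empty
      (fun k => (measurableSet_eq_fun (hgm (φ k)) hhm).compl) ?_
    filter_upwards [habs.ae_le hae] with x hx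
    filter_upwards [hx] with k hk
    simp [hk]
  have hreal : Tendsto (fun k => 2 * P.real {x | g (φ k) x ≠ h x}) atTop (𝓝 0) := by
    simpa using! ((ENNReal.tendsto_toReal (measure_ne_top P ∅)).comp hlim).const_mul 2
  refine squeeze_zero (fun k => tvDist_nonneg _ _) (fun k => ?_) hreal
  rw [hQg (φ k)]
  exact tvDist_compProd_deterministic_le P (hgm (φ k)) hhm
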